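/- arXiv:2302.05691 — 8 statements merged into one kernel-verified Lean document; each statement's English description precedes it below -/
import Mathlib

section
/- Let T be a soft topology on X with parameter set E. Then for each e ∈ E, the collection Σ_e = {F e : F ∈ T} of subsets of X is a (crisp) topology on X: it contains ∅ and Set.univ, is closed under binary intersections, and is closed under arbitrary unions of subfamilies. -/
/-- A collection of soft sets (functions `E → Set X`) is a soft topology on `X`. -/
def IsSoftTopology {X E : Type*} (T : Set (E → Set X)) : Prop :=
  (fun _ : E => (∅ : Set X)) ∈ T ∧
  (fun _ : E => (Set.univ : Set X)) ∈ T ∧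
  (∀ F ∈ T, ∀ G ∈ T, (fun e => F e ∩ G e) ∈ T) ∧
  (∀ S ⊆ T, (fun e => ⋃ F ∈ S, F e) ∈ T)

/-- for each parameter `e`, the crisp collection
`Σ_e = {F e : F ∈ T}` obtained from a soft topology `T` is a topology on `X`:
it contains `∅` and `Set.univ`, is closed under binary intersections, and is
closed under arbitrary unions of subfamilies. -/
theorem crisp_topology_of_softTopology {X E : Type*} {T : Set (E → Set X)}
    (hT : IsSoftTopology T) (e : E) :
    (∅ : Set X) ∈ {s : Set X | ∃ F ∈ T, F e = s} ∧
    (Set.univ : Set X) ∈ {s : Set X | ∃ F ∈ T, F e = s} ∧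
    (∀ s ∈ {s : Set X | ∃ F ∈ T, F e = s}, ∀ u ∈ {s : Set X | ∃ F ∈ T, F e = s},
      s ∩ u ∈ {s : Set X | ∃ F ∈ T, F e = s}) ∧
    (∀ 𝒞 ⊆ {s : Set X | ∃ F ∈ T, F e = s},
      ⋃₀ 𝒞 ∈ {s : Set X | ∃ F ∈ T, F e = s}) := by
  obtain ⟨h0, h1, h2, h3⟩ := hT
  refine ⟨⟨_, h0, rfl⟩, ⟨_, h1, rfl⟩, ?_, ?_⟩
  · rintro _ ⟨F, hF, rfl⟩ _ ⟨G, hG, rfl⟩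
    exact ⟨_, h2 F hF G hG, rfl⟩
  · intro 𝒞 hC
    refine ⟨_, h3 {F | F ∈ T ∧ F e ∈ 𝒞} (fun F hF => hF.1), ?_⟩
    ext x
    simp only [Set.mem_iUnion, Set.mem_sUnion, Set.mem_setOf_eq]
    constructor
    · rintro ⟨F, ⟨_, hF⟩, hx⟩
      exact ⟨F e, hF, hx⟩
    · rintro ⟨s, hs, hx⟩
      obtain ⟨F, hF, rfl⟩ := hC hs
      exact ⟨F, ⟨hF, hs⟩, hx⟩
end

section
/- Let t : E → TopologicalSpace X be a family of topologies on X, and for each e ∈ E let β e be a topological basis for t e. Define ℬ = {F : E → Set X | ∀ e, F e ∈ β e ∪ {∅}}. Then ℬ is a soft base for 𝒯(𝔰): every member of ℬ belongs to 𝒯(𝔰), and every F ∈ 𝒯(𝔰) is the pointwise union of some subfamily S ⊆ ℬ, i.e., F e = ⋃ G ∈ S, G e for every e ∈ E. -/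
/-- Formula 1: the soft topology generated by a family of crisp topologies. -/
def FormulaOne {X E : Type*} (t : E → TopologicalSpace X) : Set (E → Set X) :=
  {F : E → Set X | ∀ e : E, @IsOpen X (t e) (F e)}

/-- if `β e` is a topological basis for `t e` for every `e`, then
`ℬ = {F | ∀ e, F e ∈ β e ∪ {∅}}` is a soft base for `𝒯(𝔰)`: every member of `ℬ`
belongs to `𝒯(𝔰)`, and every `F ∈ 𝒯(𝔰)` is the pointwise union of a subfamily
of `ℬ`. -/
theorem formulaOne_base {X E : Type*} (t : E → TopologicalSpace X)
    (β : E → Set (Set X))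
    (hβ : ∀ e : E, @TopologicalSpace.IsTopologicalBasis X (t e) (β e)) :
    (∀ F ∈ {F : E → Set X | ∀ e : E, F e ∈ β e ∪ {∅}}, F ∈ FormulaOne t) ∧
    (∀ F ∈ FormulaOne t,
      ∃ S ⊆ {F : E → Set X | ∀ e : E, F e ∈ β e ∪ {∅}},
        ∀ e : E, F e = ⋃ G ∈ S, G e) := by
  classical
  constructor
  · intro F hF e
    rcases hF e with h | h
    · exact @TopologicalSpace.IsTopologicalBasis.isOpen X (t e) _ _ (hβ e) h
    · have h' : F e = ∅ := h
      rw [h']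
      exact @isOpen_empty X (t e)
  · intro F hF
    refine ⟨{G | (∀ e, G e ∈ β e ∪ {∅}) ∧ ∀ e, G e ⊆ F e}, fun G hG => hG.1, ?_⟩
    intro e
    apply Set.Subset.antisymm
    · intro x hx
      obtain ⟨u, hu, hxu, huF⟩ :=
        @TopologicalSpace.IsTopologicalBasis.exists_subset_of_mem_open X (t e) _ (hβ e) x (F e)
          hx (hF e)
      refine Set.mem_iUnion₂.2 ⟨Function.update (fun _ => ∅) e u, ⟨?_, ?_⟩, ?_⟩
      · intro e'
        by_cases h : e' = e
        · subst h
          simp [hu]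
        · simp [Function.update_of_ne h]
      · intro e'
        by_cases h : e' = e
        · subst h
          simpa using huF
        · simp [Function.update_of_ne h]
      · simpa using hxu
    · exact Set.iUnion₂_subset fun G hG => hG.2 e
end

section
/- Let t : E → TopologicalSpace X be a family of topologies on X. Then the soft topology generated by ⋃_{e ∈ E} 𝒯̂(t e) equals 𝒯̂(τ), where τ = ⨆_{e ∈ E} t e is the topology on X generated by the union of the open-set collections of the topologies t e; that is, the intersection of all soft topologies on X containing ⋃_{e ∈ E} 𝒯̂(t e) coincides with {F : E → Set X | ∃ U open in τ, ∀ e', F e' = U}. -/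
/-- The soft topology generated by a family `𝓕` of soft sets: the intersection of
all soft topologies on `X` containing `𝓕`. -/
def SoftGenerated {X E : Type*} (𝓕 : Set (E → Set X)) : Set (E → Set X) :=
  ⋂₀ {T : Set (E → Set X) | IsSoftTopology T ∧ 𝓕 ⊆ T}

/-- Formula 2: the single set soft topology generated by a crisp topology `τ`. -/
def FormulaTwo (E : Type*) {X : Type*} (τ : TopologicalSpace X) : Set (E → Set X) :=
  {F : E → Set X | ∃ U : Set X, @IsOpen X τ U ∧ ∀ e : E, F e = U}

/-- the soft topology generated by `⋃ e, 𝒯̂(t e)` equals the single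
set soft topology `𝒯̂(τ)`, where `τ` is the topology on `X` generated by the union
of the open-set collections of the topologies `t e` (in Mathlib's order on
`TopologicalSpace`, this is `⨅ e, t e`). -/
theorem softGenerated_union_formulaTwo {X E : Type*} (t : E → TopologicalSpace X) :
    SoftGenerated (⋃ e : E, FormulaTwo E (t e)) =
      FormulaTwo E
        (TopologicalSpace.generateFrom (⋃ e : E, {s : Set X | @IsOpen X (t e) s})) := by
  apply Set.Subset.antisymm
  · apply Set.sInter_subset_of_mem
    refine ⟨⟨?_, ?_, ?_, ?_⟩, ?_⟩
    · exact ⟨∅, @isOpen_empty X (TopologicalSpace.generateFrom _), fun _ => rfl⟩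
    · exact ⟨Set.univ, @isOpen_univ X (TopologicalSpace.generateFrom _), fun _ => rfl⟩
    · rintro F ⟨U, hU, hF⟩ G ⟨V, hV, hG⟩
      exact ⟨U ∩ V, TopologicalSpace.GenerateOpen.inter _ _ hU hV,
        fun e => by simp only [hF, hG]⟩
    · intro S hS
      choose! U hU hF using hS
      refine ⟨⋃₀ (U '' S), TopologicalSpace.GenerateOpen.sUnion _ ?_, ?_⟩
      · rintro _ ⟨F, hFS, rfl⟩
        exact hU hFS
      · intro e
        rw [Set.sUnion_image]
        exact Set.iUnion₂_congr fun F hFS => hF hFS e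
    · intro F hF
      obtain ⟨e, U, hU, hF⟩ := Set.mem_iUnion.1 hF
      exact ⟨U, TopologicalSpace.GenerateOpen.basic _ (Set.mem_iUnion.2 ⟨e, hU⟩), hF⟩
  · rintro F ⟨U, hU, hF⟩ T ⟨⟨_, h1, h2, h3⟩, hT⟩
    obtain rfl : F = fun _ => U := funext hF
    clear hF
    change TopologicalSpace.GenerateOpen _ U at hU
    induction hU with
    | basic s hs =>
      obtain ⟨e, hs⟩ := Set.mem_iUnion.1 hs
      exact hT (Set.mem_iUnion.2 ⟨e, s, hs, fun _ => rfl⟩)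
    | univ => exact h1
    | inter s u _ _ ihs ihu => exact h2 _ ihs _ ihu
    | sUnion S _ ih =>
      have h := h3 ((fun (s : Set X) (_ : E) => s) '' S) (by
        rintro _ ⟨s, hs, rfl⟩
        exact ih s hs)
      simpa [Set.biUnion_image, Set.sUnion_eq_biUnion] using h
end

section
/- Let t : E → TopologicalSpace X be a family of topologies on X. If t e₀ is a T0 topology for some e₀ ∈ E, then 𝒯(𝔰) is soft T0: for all x, y ∈ X with x ≠ y, there exist soft sets U, V ∈ 𝒯(𝔰) such that either (x ∈ U e for every e and y ∉ U e for some e) or (x ∉ V e for some e and y ∈ V e for every e). -/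
/-- if `t e₀` is a T0 topology for some `e₀`, then `𝒯(𝔰)` is
soft T0. -/
theorem formulaOne_soft_t0 {X E : Type*} (t : E → TopologicalSpace X)
    (e₀ : E) (h : @T0Space X (t e₀)) :
    ∀ x y : X, x ≠ y →
      ∃ U ∈ FormulaOne t, ∃ V ∈ FormulaOne t,
        ((∀ e : E, x ∈ U e) ∧ (∃ e : E, y ∉ U e)) ∨
        ((∃ e : E, x ∉ V e) ∧ (∀ e : E, y ∈ V e)) := by
  intro x y hxy
  obtain ⟨O, hO, hx⟩ := @exists_isOpen_xor_mem X (t e₀) h x y hxy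
  have hW : (fun e => {z : X | e = e₀ → z ∈ O}) ∈ FormulaOne t := by
    intro e
    by_cases he : e = e₀
    · subst he
      simpa using hO
    · simp [he]
  refine ⟨_, hW, _, hW, ?_⟩
  rcases hx with ⟨h1, h2⟩ | ⟨h1, h2⟩
  · exact Or.inl ⟨fun _ _ => h1, e₀, fun k => h2 (k rfl)⟩
  · exact Or.inr ⟨⟨e₀, fun k => h2 (k rfl)⟩, fun _ _ => h1⟩
end

section
/- Let t : E → TopologicalSpace X be a family of topologies on X. If t e₀ is a T1 topology for some e₀ ∈ E, then 𝒯(𝔰) is soft T1: for all x, y ∈ X with x ≠ y, there exist soft sets U, V ∈ 𝒯(𝔰) such that x ∈ U e for every e, y ∉ U e for some e, x ∉ V e for some e, and y ∈ V e for every e. -/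
theorem formulaOne_aux {X E : Type*} (t : E → TopologicalSpace X)
    (e₀ : E) (h : @T1Space X (t e₀)) (y : X) :
    (fun e : E => {z : X | e = e₀ → z ≠ y}) ∈ FormulaOne t := by
  intro e
  by_cases he : e = e₀
  · subst he
    have h1 : {z : X | e = e → z ≠ y} = {y}ᶜ := by ext z; simp
    show @IsOpen X (t e) {z : X | e = e → z ≠ y}
    rw [h1]
    letI := t e
    exact isOpen_compl_singleton
  · have h1 : {z : X | e = e₀ → z ≠ y} = Set.univ := by ext z; simp [he]
    show @IsOpen X (t e) {z : X | e = e₀ → z ≠ y}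
    rw [h1]
    exact @isOpen_univ X (t e)

/-- if `t e₀` is a T1 topology for some `e₀`, then `𝒯(𝔰)` is
soft T1. -/
theorem formulaOne_soft_t1 {X E : Type*} (t : E → TopologicalSpace X)
    (e₀ : E) (h : @T1Space X (t e₀)) :
    ∀ x y : X, x ≠ y →
      ∃ U ∈ FormulaOne t, ∃ V ∈ FormulaOne t,
        (∀ e : E, x ∈ U e) ∧ (∃ e : E, y ∉ U e) ∧
        (∃ e : E, x ∉ V e) ∧ (∀ e : E, y ∈ V e) := by
  intro x y hxy
  exact ⟨_, formulaOne_aux t e₀ h y, _, formulaOne_aux t e₀ h x,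
    fun _ _ => hxy, ⟨e₀, fun k => k rfl rfl⟩, ⟨e₀, fun k => k rfl rfl⟩, fun _ _ => hxy.symm⟩
end

section
/- Let t : E → TopologicalSpace X be a family of topologies on X. Then t e is a T2 (Hausdorff) topology for every e ∈ E if and only if 𝒯(𝔰) is soft T2: for all x, y ∈ X with x ≠ y, there exist soft sets U, V ∈ 𝒯(𝔰) such that x ∈ U e for every e, y ∈ V e for every e, and U e ∩ V e = ∅ for every e. -/
/-- `t e` is Hausdorff for every `e` if and only if `𝒯(𝔰)` is
soft T2. -/
theorem formulaOne_soft_t2_iff {X E : Type*} (t : E → TopologicalSpace X) :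
    (∀ e : E, @T2Space X (t e)) ↔
      (∀ x y : X, x ≠ y →
        ∃ U ∈ FormulaOne t, ∃ V ∈ FormulaOne t,
          (∀ e : E, x ∈ U e) ∧ (∀ e : E, y ∈ V e) ∧
          (∀ e : E, U e ∩ V e = ∅)) := by
  constructor
  · intro h x y hxy
    have key : ∀ e : E, ∃ u v : Set X, @IsOpen X (t e) u ∧ @IsOpen X (t e) v ∧
        x ∈ u ∧ y ∈ v ∧ Disjoint u v := fun e => (h e).t2 hxy
    choose U V hU hV hx hy hd using key
    exact ⟨U, hU, V, hV, hx, hy, fun e => Set.disjoint_iff_inter_eq_empty.mp (hd e)⟩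
  · intro h e
    refine @T2Space.mk X (t e) ?_
    intro x y hxy
    obtain ⟨U, hU, V, hV, hx, hy, hd⟩ := h x y hxy
    exact ⟨U e, V e, hU e, hV e, hx e, hy e, Set.disjoint_iff_inter_eq_empty.mpr (hd e)⟩
end

section
/- Let T be a soft topology on X with parameter set E that is soft regular: for every soft closed set F (i.e., fun e => (F e)ᶜ belongs to T) and every x ∈ X with x ∉ F e for some e, there exist U, V ∈ T such that x ∈ U e for every e, F e ⊆ V e for every e, and U e ∩ V e = ∅ for every e. Then the induced crisp topologies all coincide: for all e, e' ∈ E, {F e : F ∈ T} = {F e' : F ∈ T}. -/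
/-- if a soft topology `T` is soft regular, then the induced crisp
topologies all coincide: `{F e : F ∈ T} = {F e' : F ∈ T}` for all `e, e'`. -/
theorem crisp_topologies_eq_of_soft_regular {X E : Type*} {T : Set (E → Set X)}
    (hT : IsSoftTopology T)
    (hreg : ∀ F : E → Set X, (fun e => (F e)ᶜ) ∈ T →
      ∀ x : X, (∃ e : E, x ∉ F e) →
        ∃ U ∈ T, ∃ V ∈ T,
          (∀ e : E, x ∈ U e) ∧ (∀ e : E, F e ⊆ V e) ∧ (∀ e : E, U e ∩ V e = ∅)) :
    ∀ e e' : E, {s : Set X | ∃ F ∈ T, F e = s} = {s : Set X | ∃ F ∈ T, F e' = s} := by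
  -- every soft open set is constant in the parameter
  have key : ∀ F ∈ T, ∀ a b : E, F a ⊆ F b := by
    intro F hF a b x hx
    obtain ⟨U, _, V, _, hxU, hFV, hd⟩ := hreg (fun e => (F e)ᶜ)
      (by simpa only [compl_compl] using hF) x ⟨a, fun h => h hx⟩
    by_contra hb
    have hmem : x ∈ U b ∩ V b := ⟨hxU b, hFV b hb⟩
    rw [hd b] at hmem
    exact hmem
  intro e e'
  ext s
  constructor
  · rintro ⟨F, hF, rfl⟩
    exact ⟨F, hF, (key F hF e' e).antisymm (key F hF e e')⟩
  · rintro ⟨F, hF, rfl⟩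
    exact ⟨F, hF, (key F hF e e').antisymm (key F hF e' e)⟩
end

section
/- Let t : E → TopologicalSpace X be a family of topologies on X. Then (X, t e) is a normal space for every e ∈ E if and only if 𝒯(𝔰) is soft normal: for all soft sets F, G whose pointwise complements fun e => (F e)ᶜ and fun e => (G e)ᶜ belong to 𝒯(𝔰) and which satisfy F e ∩ G e = ∅ for every e, there exist U, V ∈ 𝒯(𝔰) such that F e ⊆ U e for every e, G e ⊆ V e for every e, and U e ∩ V e = ∅ for every e. -/
/-- `(X, t e)` is a normal space for every `e` if and only if
`𝒯(𝔰)` is soft normal: disjoint soft closed sets can be separated by disjoint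
soft open sets. -/
theorem formulaOne_soft_normal_iff {X E : Type*} (t : E → TopologicalSpace X) :
    (∀ e : E, @NormalSpace X (t e)) ↔
      (∀ F G : E → Set X,
        (fun e => (F e)ᶜ) ∈ FormulaOne t → (fun e => (G e)ᶜ) ∈ FormulaOne t →
        (∀ e : E, F e ∩ G e = ∅) →
          ∃ U ∈ FormulaOne t, ∃ V ∈ FormulaOne t,
            (∀ e : E, F e ⊆ U e) ∧ (∀ e : E, G e ⊆ V e) ∧
            (∀ e : E, U e ∩ V e = ∅)) := by
  constructor
  · intro h F G hF hG hd
    have key : ∀ e, ∃ U V : Set X, @IsOpen X (t e) U ∧ @IsOpen X (t e) V ∧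
        F e ⊆ U ∧ G e ⊆ V ∧ Disjoint U V := by
      intro e
      exact (h e).normal (F e) (G e) ((@isOpen_compl_iff X (F e) (t e)).1 (hF e))
        ((@isOpen_compl_iff X (G e) (t e)).1 (hG e))
        (Set.disjoint_iff_inter_eq_empty.2 (hd e))
    choose U V hU hV hFU hGV hUV using key
    exact ⟨U, hU, V, hV, hFU, hGV, fun e => Set.disjoint_iff_inter_eq_empty.1 (hUV e)⟩
  · intro h e
    refine @NormalSpace.mk X (t e) ?_
    intro A B hA hB hAB
    have aux : ∀ C : Set X, @IsClosed X (t e) C →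
        (fun e' => ({x | e' = e ∧ x ∈ C} : Set X)ᶜ) ∈ FormulaOne t := by
      intro C hC e'
      by_cases he : e' = e
      · subst he
        simpa using (@isOpen_compl_iff X C (t e')).2 hC
      · simp [he]
    obtain ⟨U, hU, V, hV, hAU, hBV, hUV⟩ := h (fun e' => {x | e' = e ∧ x ∈ A})
      (fun e' => {x | e' = e ∧ x ∈ B}) (aux A hA) (aux B hB) (by
        intro e'
        ext x
        simp only [Set.mem_inter_iff, Set.mem_setOf_eq, Set.mem_empty_iff_false, iff_false]
        rintro ⟨⟨_, ha⟩, _, hb⟩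
        exact Set.disjoint_left.1 hAB ha hb)
    exact ⟨U e, V e, hU e, hV e, fun x hx => hAU e ⟨rfl, hx⟩, fun x hx => hBV e ⟨rfl, hx⟩,
      Set.disjoint_iff_inter_eq_empty.2 (hUV e)⟩
end
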